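/- The series ∑_{n=0}^∞ ((1/2)_n (1/4)_n (3/4)_n)/((1)_n^3) · (28n+3) · (-1/48)^n equals 16√3/(3π). -/

import Mathlib

open Real

noncomputable def poch (a : ℝ) (n : ℕ) : ℝ := (ascPochhammer ℝ n).eval a

/-! A WZ proof.  `KK n j` is a proper hypergeometric term, `FF`, `GG` a WZ pair built on it. -/

noncomputable def rho (n j : ℕ) : ℝ :=
  (4*(n:ℝ)+1)*(4*n+3)/((4*n+2)*(4*n+4))/48 * ((3*(j:ℝ)+n+1/2)*(j-n-1/2)/((j:ℝ)+n+1)^2)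

noncomputable def kap (j : ℕ) : ℝ :=
  ∏ i ∈ Finset.range j, (((i:ℝ)+1/6)*(i+5/6)/((i:ℝ)+1)^2)

noncomputable def KK (n j : ℕ) : ℝ := kap j * ∏ i ∈ Finset.range n, rho i j

noncomputable def br (n j : ℕ) : ℝ :=
  (3*(j:ℝ)+5*n+1/2)
  + (3*(j:ℝ)+5*n+9/2)*(4*n+1)*(3*j+n+1/2)*(3*j+n+3/2)/(72*(2*n+1)*((j:ℝ)+n+1)^2)
  + (4*(n:ℝ)+3)^2*(4*n+1)*(3*j+n+1/2)/(288*(2*n+1)*((j:ℝ)+n+1)^2)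

noncomputable def FF (n j : ℕ) : ℝ := KK n j * br n j

noncomputable def GG (n j : ℕ) : ℝ :=
  -(2/3)*(2*(n:ℝ))*(4*n-1)/((j:ℝ)-n+1/2) * KK n j

lemma half_abs (m : ℤ) : (1:ℝ)/2 ≤ |(m:ℝ)+1/2| := by
  rcases le_or_gt 0 m with h | h
  · have : (0:ℝ) ≤ m := by exact_mod_cast h
    rw [abs_of_nonneg (by linarith)]; linarith
  · have : (m:ℝ) ≤ -1 := by exact_mod_cast (by omega : m ≤ -1)
    rw [abs_of_neg (by linarith)]; linarith

lemma half_abs1 (n j : ℕ) : (1:ℝ)/2 ≤ |(j:ℝ)-n+1/2| := by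
  have := half_abs ((j:ℤ)-n)
  push_cast at this; exact this

lemma half_ne1 (n j : ℕ) : (j:ℝ)-n+1/2 ≠ 0 := by
  intro h
  have := half_abs1 n j
  rw [h, abs_zero] at this; norm_num at this

lemma half_ne2 (n j : ℕ) : (j:ℝ)-n-1/2 ≠ 0 := by
  have := half_ne1 (n+1) j
  push_cast at this
  intro h; apply this; linarith

lemma KK_succ_left (n j : ℕ) : KK (n+1) j = KK n j * rho n j := by
  unfold KK; rw [Finset.prod_range_succ]; ring

lemma KK_succ_right (n j : ℕ) : KK n (j+1) = KK n j *
    ((3*(j:ℝ)+n+1/2)*(3*j+n+3/2)*(3*j+n+5/2)/(27*((j:ℝ)-n+1/2)*((j:ℝ)+n+1)^2)) := by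
  induction n with
  | zero =>
    have h1 : (j:ℝ)+1/2 ≠ 0 := by positivity
    have h2 : (j:ℝ)+1 ≠ 0 := by positivity
    simp only [KK, kap, Finset.prod_range_succ, Finset.prod_range_zero]
    push_cast
    simp only [add_zero, sub_zero, mul_one]
    field_simp
    ring
  | succ n ih =>
    rw [KK_succ_left, KK_succ_left, ih]
    have h1 := half_ne1 n j
    have h2 := half_ne2 n j
    have h1' : (j:ℝ)*2-n*2+1 ≠ 0 := by intro h; apply h1; linarith
    have h2' : (j:ℝ)*2-n*2-1 ≠ 0 := by intro h; apply h2; linarith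
    have h3 : (j:ℝ)+n+1 ≠ 0 := by positivity
    have h4 : (j:ℝ)+n+2 ≠ 0 := by positivity
    have h5 : (j:ℝ)+n+1+1 ≠ 0 := by positivity
    have e1 : rho n (j+1) = (4*(n:ℝ)+1)*(4*n+3)/((4*n+2)*(4*n+4))/48 * ((3*(j:ℝ)+n+7/2)*((j:ℝ)-n+1/2)/((j:ℝ)+n+2)^2) := by
      unfold rho; push_cast; ring
    have e2 : ((j:ℝ) - (n+1:ℕ) + 1/2) = (j:ℝ)-n-1/2 := by push_cast; ring
    have e3 : ((j:ℝ) + (n+1:ℕ) + 1) = (j:ℝ)+n+2 := by push_cast; ring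
    rw [e1, e2, e3]
    unfold rho
    push_cast
    generalize KK n j = k
    have h6 : (4*(n:ℝ)+2) ≠ 0 := by positivity
    have h7 : (4*(n:ℝ)+4) ≠ 0 := by positivity
    generalize hu : (j:ℝ)-n+1/2 = u at *
    generalize hv : (j:ℝ)-n-1/2 = v at *
    field_simp
    ring

lemma wz (n j : ℕ) : FF n (j+1) - FF n j = GG (n+1) j - GG n j := by
  have h1 := half_ne1 n j
  have h2 := half_ne2 n j
  have h3 : (j:ℝ)+n+1 ≠ 0 := by positivity
  have h4 : (j:ℝ)+n+2 ≠ 0 := by positivity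
  have h6 : (2*(n:ℝ)+1) ≠ 0 := by positivity
  have h7 : ((n:ℝ)+1) ≠ 0 := by positivity
  have e2 : ((j:ℝ) - (n+1:ℕ) + 1/2) = (j:ℝ)-n-1/2 := by push_cast; ring
  have e3 : (((j+1:ℕ):ℝ) + n + 1) = (j:ℝ)+n+2 := by push_cast; ring
  have eG : GG (n+1) j = -(1/288)*(4*(n:ℝ)+3)^2*(4*n+1)*(3*(j:ℝ)+n+1/2)/((2*n+1)*((j:ℝ)+n+1)^2) * KK n j := by
    unfold GG
    rw [KK_succ_left, e2]
    unfold rho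
    push_cast
    rw [show (4*(n:ℝ)+2) = 2*(2*n+1) by ring, show (4*(n:ℝ)+4) = 4*(n+1) by ring]
    generalize hv : (j:ℝ)-n-1/2 = v at *
    field_simp
    ring
  rw [eG]
  unfold FF GG
  rw [KK_succ_right]
  unfold br
  rw [e3]
  push_cast
  generalize KK n j = k
  clear eG e2 e3 h2 h7
  generalize hu : (j:ℝ)-n+1/2 = u at *
  generalize hd : (j:ℝ)+n+1 = d at *
  generalize he : (j:ℝ)+n+2 = e at *
  generalize hw : 2*(n:ℝ)+1 = w at *
  field_simp
  subst hu hd he hw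
  ring

lemma GG_zero (j : ℕ) : GG 0 j = 0 := by simp [GG]

lemma kap_pos (j : ℕ) : 0 < kap j := by
  unfold kap; apply Finset.prod_pos; intros; positivity

lemma kap_eq (j : ℕ) : kap j * (3*(j:ℝ)+1/2) =
    1/2 * ∏ i ∈ Finset.range j, ((1:ℝ) - (1/6)^2/((i:ℝ)+1)^2) := by
  induction j with
  | zero => simp [kap]
  | succ j ih =>
    rw [Finset.prod_range_succ, ← mul_assoc, ← ih]
    unfold kap
    rw [Finset.prod_range_succ]
    push_cast
    field_simp
    ring

lemma kap_le (j : ℕ) : kap j * (3*(j:ℝ)+1/2) ≤ 1/2 := by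
  induction j with
  | zero => simp [kap]
  | succ j ih =>
    refine le_trans ?_ ih
    have hk := kap_pos j
    have : kap (j+1) = kap j * (((j:ℝ)+1/6)*(j+5/6)/((j:ℝ)+1)^2) := by
      unfold kap; rw [Finset.prod_range_succ]
    rw [this, mul_assoc]
    apply mul_le_mul_of_nonneg_left _ hk.le
    push_cast
    rw [div_mul_eq_mul_div, div_le_iff₀ (by positivity)]
    have : (0:ℝ) ≤ j := by positivity
    nlinarith

lemma kap_tendsto : Filter.Tendsto (fun j : ℕ => kap j * (3*(j:ℝ)+1/2)) Filter.atTop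
    (nhds (3/(2*π))) := by
  have h := Real.tendsto_euler_sin_prod (1/6)
  have h2 := h.const_mul (3/π)
  have e : (3/π) * sin (π*(1/6)) = 3/(2*π) := by
    rw [show π*(1/6) = π/6 by ring, Real.sin_pi_div_six]
    field_simp
  rw [e] at h2
  refine h2.congr (fun j => ?_)
  rw [kap_eq]
  have := Real.pi_ne_zero
  field_simp
  ring

lemma rho_abs (n j : ℕ) : |rho n j| ≤ 1/16 := by
  unfold rho
  rw [abs_mul]
  have a1 : |(4*(n:ℝ)+1)*(4*n+3)/((4*n+2)*(4*n+4))/48| ≤ 1/48 := by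
    rw [abs_of_nonneg (by positivity)]
    rw [div_le_div_iff_of_pos_right (by norm_num), div_le_one (by positivity)]
    have : (0:ℝ) ≤ n := by positivity
    nlinarith
  have a2 : |(3*(j:ℝ)+n+1/2)*(j-n-1/2)/((j:ℝ)+n+1)^2| ≤ 3 := by
    rw [abs_div, abs_mul, div_le_iff₀ (by positivity), abs_of_nonneg (by positivity : (0:ℝ) ≤ 3*(j:ℝ)+n+1/2),
      abs_of_nonneg (by positivity : (0:ℝ) ≤ ((j:ℝ)+n+1)^2)]
    have hj : (0:ℝ) ≤ j := by positivity
    have hn : (0:ℝ) ≤ n := by positivity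
    have b1 : |(j:ℝ)-n-1/2| ≤ (j:ℝ)+n+1 := by rw [abs_le]; constructor <;> linarith
    have b2 : 3*(j:ℝ)+n+1/2 ≤ 3*((j:ℝ)+n+1) := by linarith
    calc _ ≤ 3*((j:ℝ)+n+1) * ((j:ℝ)+n+1) := by gcongr
      _ = _ := by ring
  calc _ ≤ (1/48:ℝ) * 3 := by gcongr
    _ = _ := by norm_num

lemma KK_abs (n j : ℕ) : |KK n j| ≤ kap j * (1/16)^n := by
  unfold KK
  rw [abs_mul, abs_of_pos (kap_pos j), Finset.abs_prod]
  apply mul_le_mul_of_nonneg_left _ (kap_pos j).le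
  calc _ ≤ ∏ i ∈ Finset.range n, (1/16:ℝ) :=
        Finset.prod_le_prod (fun i _ => abs_nonneg _) (fun i _ => rho_abs i j)
    _ = _ := by simp

lemma br_nonneg (n j : ℕ) : 0 ≤ br n j := by unfold br; positivity

lemma br_le (n j : ℕ) : br n j ≤ (3*(j:ℝ)+1/2) * (20*((n:ℝ)+1)) := by
  have hj : (0:ℝ) ≤ j := by positivity
  have hn : (0:ℝ) ≤ n := by positivity
  unfold br
  have a2 : (3*(j:ℝ)+5*n+9/2)*(4*n+1)*(3*j+n+1/2)*(3*j+n+3/2)/(72*(2*n+1)*((j:ℝ)+n+1)^2)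
      ≤ (3*(j:ℝ)+5*n+9/2)/4 := by
    rw [div_le_iff₀ (by positivity)]
    have c1 : (4*(n:ℝ)+1) ≤ 2*(2*n+1) := by linarith
    have c2 : (3*(j:ℝ)+n+1/2) ≤ 3*((j:ℝ)+n+1) := by linarith
    have c3 : (3*(j:ℝ)+n+3/2) ≤ 3*((j:ℝ)+n+1) := by linarith
    calc _ ≤ (3*(j:ℝ)+5*n+9/2)*(2*(2*n+1))*(3*((j:ℝ)+n+1))*(3*((j:ℝ)+n+1)) := by gcongr
      _ = _ := by ring
  have a3 : (4*(n:ℝ)+3)^2*(4*n+1)*(3*j+n+1/2)/(288*(2*n+1)*((j:ℝ)+n+1)^2) ≤ ((n:ℝ)+1)/3 := by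
    rw [div_le_iff₀ (by positivity)]
    have c1 : (4*(n:ℝ)+1) ≤ 2*(2*n+1) := by linarith
    have c2 : (3*(j:ℝ)+n+1/2) ≤ 3*((j:ℝ)+n+1) := by linarith
    have c3 : (4*(n:ℝ)+3)^2 ≤ 16*((n:ℝ)+1)*((j:ℝ)+n+1) := by nlinarith [mul_nonneg hj hn]
    calc _ ≤ (16*((n:ℝ)+1)*((j:ℝ)+n+1))*(2*(2*n+1))*(3*((j:ℝ)+n+1)) := by gcongr
      _ = _ := by ring
  nlinarith [mul_nonneg hj hn]

lemma FF_abs (n j : ℕ) : ‖FF n j‖ ≤ 10*((n:ℝ)+1)*(1/16)^n := by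
  unfold FF
  rw [Real.norm_eq_abs, abs_mul, abs_of_nonneg (br_nonneg n j)]
  have hk := kap_pos j
  calc _ ≤ (kap j * (1/16)^n) * ((3*(j:ℝ)+1/2) * (20*((n:ℝ)+1))) := by
        gcongr
        · exact br_nonneg n j
        · exact KK_abs n j
        · exact br_le n j
    _ = (kap j * (3*(j:ℝ)+1/2)) * (20*((n:ℝ)+1) * (1/16)^n) := by ring
    _ ≤ 1/2 * (20*((n:ℝ)+1) * (1/16)^n) := by
        gcongr
        exact kap_le j
    _ = _ := by ring

lemma bound_summable : Summable (fun n : ℕ => 10*((n:ℝ)+1)*(1/16:ℝ)^n) := by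
  have h1 := (summable_pow_mul_geometric_of_norm_lt_one (R := ℝ) 1 (r := 1/16) (by norm_num)).mul_left 10
  have h2 := (summable_pow_mul_geometric_of_norm_lt_one (R := ℝ) 0 (r := 1/16) (by norm_num)).mul_left 10
  refine (h1.add h2).congr (fun n => ?_)
  simp; ring

lemma FF_summable (j : ℕ) : Summable (fun n => FF n j) :=
  Summable.of_norm_bounded bound_summable (fun n => FF_abs n j)

lemma GG_tendsto (j : ℕ) : Filter.Tendsto (fun n => GG n j) Filter.atTop (nhds 0) := by
  have h1 := (summable_pow_mul_geometric_of_norm_lt_one (R := ℝ) 2 (r := 1/16) (by norm_num)).mul_left (16 * kap j)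
  have h2 := (summable_pow_mul_geometric_of_norm_lt_one (R := ℝ) 1 (r := 1/16) (by norm_num)).mul_left (16 * kap j)
  refine squeeze_zero_norm (fun n => ?_) ((h1.add h2).tendsto_atTop_zero)
  unfold GG
  rw [Real.norm_eq_abs, abs_mul, abs_div]
  have hk := kap_pos j
  have a1 : |-(2/3)*(2*(n:ℝ))*(4*n-1)| ≤ 8*((n:ℝ)^2+n) := by
    have hn : (0:ℝ) ≤ n := by positivity
    rw [abs_le]; constructor <;> nlinarith
  calc _ ≤ (8*((n:ℝ)^2+n)) / (1/2) * (kap j * (1/16)^n) := by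
        gcongr
        · exact half_abs1 n j
        · exact KK_abs n j
    _ = _ := by ring

lemma sum_step (j : ℕ) : ∑' n, FF n (j+1) = ∑' n, FF n j := by
  have h1 := (FF_summable (j+1)).hasSum.tendsto_sum_nat
  have h2 := (FF_summable j).hasSum.tendsto_sum_nat
  have h3 := h1.sub h2
  have h4 : Filter.Tendsto (fun N => ∑ n ∈ Finset.range N, FF n (j+1) - ∑ n ∈ Finset.range N, FF n j)
      Filter.atTop (nhds 0) := by
    refine (GG_tendsto j).congr (fun N => ?_)
    rw [← Finset.sum_sub_distrib]
    simp_rw [wz]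
    rw [Finset.sum_range_sub (fun n => GG n j), GG_zero, sub_zero]
  have := tendsto_nhds_unique h3 h4
  linarith

lemma sum_const (j : ℕ) : ∑' n, FF n j = ∑' n, FF n 0 := by
  induction j with
  | zero => rfl
  | succ j ih => rw [sum_step, ih]

/-- coefficients of `(1 - 1/4)^(-1/2)` -/
noncomputable def cc (k : ℕ) : ℝ := ∏ i ∈ Finset.range k, (((i:ℝ)+1/2)/(4*((i:ℝ)+1)))

lemma cc_succ (k : ℕ) : cc (k+1) = cc k * (((k:ℝ)+1/2)/(4*((k:ℝ)+1))) := by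
  unfold cc; rw [Finset.prod_range_succ]

lemma choose_cc (k : ℕ) : Ring.choose (-1/2 : ℝ) k * (-1/4)^k = cc k := by
  rw [Ring.choose_eq_smul]
  induction k with
  | zero => simp [cc]
  | succ k ih =>
    rw [cc_succ, ← ih, descPochhammer_succ_right, Polynomial.smeval_mul, Nat.factorial_succ]
    simp only [Polynomial.smeval_sub, Polynomial.smeval_X, Polynomial.smeval_natCast, smul_eq_mul]
    have : ((k.factorial:ℕ):ℝ) ≠ 0 := by positivity
    push_cast
    simp only [pow_one, pow_zero, nsmul_eq_mul, mul_one]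
    field_simp
    ring

lemma cc_hasSum : HasSum cc (2/Real.sqrt 3) := by
  have h := (Real.one_add_rpow_hasFPowerSeriesOnBall_zero (a := -1/2)).hasSum (y := -1/4) (by
    rw [← ENNReal.ofReal_one, Metric.eball_ofReal]; norm_num [abs_lt])
  have e : ((1:ℝ) + (0 + -1/4))^(-1/2:ℝ) = 2/Real.sqrt 3 := by
    rw [show ((1:ℝ) + (0 + -1/4)) = 3/4 by norm_num, show (-1/2:ℝ) = -(1/2) by norm_num,
      Real.rpow_neg (by norm_num), ← Real.sqrt_eq_rpow, Real.sqrt_div (by norm_num),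
      show (4:ℝ) = 2^2 by norm_num, Real.sqrt_sq (by norm_num), inv_div]
  rw [e] at h
  have hk : cc = fun n => (binomialSeries ℝ (-1/2 : ℝ) n) fun _ => (-1/4 : ℝ) := by
    funext k
    rw [binomialSeries_apply, ← choose_cc]
    simp
  rw [hk]
  exact h

lemma lin_tendsto (a b d : ℝ) : Filter.Tendsto (fun j : ℕ => (a*(j:ℝ)+b)/((j:ℝ)+d)) Filter.atTop (nhds a) := by
  have h : Filter.Tendsto (fun j : ℕ => (j:ℝ)+d) Filter.atTop Filter.atTop :=
    Filter.tendsto_atTop_add_const_right _ _ tendsto_natCast_atTop_atTop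
  have h1 := (h.inv_tendsto_atTop).const_mul (b - a*d)
  have h2 := h1.const_add a
  simp only [mul_zero, add_zero] at h2
  refine h2.congr' ?_
  filter_upwards [h.eventually_gt_atTop 0] with j hj
  simp only [Pi.inv_apply]
  field_simp
  ring

lemma rho_tendsto (n : ℕ) : Filter.Tendsto (fun j => rho n j) Filter.atTop
    (nhds ((4*(n:ℝ)+1)*(4*n+3)/((4*n+2)*(4*n+4))/48 * (3*1))) := by
  unfold rho
  refine Filter.Tendsto.const_mul _ ?_
  refine ((lin_tendsto 3 ((n:ℝ)+1/2) ((n:ℝ)+1)).mul (lin_tendsto 1 (-(n:ℝ)-1/2) ((n:ℝ)+1))).congr (fun j => ?_)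
  rw [div_mul_div_comm]
  congr 1 <;> ring

lemma prod_rho_tendsto (n : ℕ) : Filter.Tendsto (fun j => ∏ i ∈ Finset.range n, rho i j) Filter.atTop
    (nhds (cc (2*n))) := by
  have h := tendsto_finset_prod (Finset.range n) (fun i _ => rho_tendsto i)
  convert h using 2
  induction n with
  | zero => simp [cc]
  | succ n ih =>
    rw [Finset.prod_range_succ, ← ih (tendsto_finset_prod _ (fun i _ => rho_tendsto i)),
      show 2*(n+1) = 2*n+1+1 by ring, cc_succ, cc_succ]
    push_cast
    field_simp
    ring

lemma br_tendsto (n : ℕ) : Filter.Tendsto (fun j : ℕ => br n j / (3*(j:ℝ)+1/2)) Filter.atTop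
    (nhds (1 + ((2*n:ℕ)+1/2)/(4*(((2*n:ℕ):ℝ)+1)))) := by
  have t0 := lin_tendsto 1 ((5*n+1/2)/3) (1/6)
  have t1 := lin_tendsto 1 ((5*n+9/2)/3) (1/6)
  have t2 := lin_tendsto 3 ((n:ℝ)+1/2) ((n:ℝ)+1)
  have t3 := lin_tendsto 3 ((n:ℝ)+3/2) ((n:ℝ)+1)
  have t4 := lin_tendsto 0 1 ((n:ℝ)+1)
  have t5 := lin_tendsto 0 (1/3) (1/6)
  have h := (t0.add (((t1.mul t2).mul t3).mul_const ((4*(n:ℝ)+1)/(72*(2*n+1))))).add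
    (((t2.mul t4).mul t5).mul_const ((4*(n:ℝ)+3)^2*(4*n+1)/(288*(2*n+1))))
  have e : (1 + 1*3*3*((4*(n:ℝ)+1)/(72*(2*n+1))) + 3*0*0*((4*(n:ℝ)+3)^2*(4*n+1)/(288*(2*n+1))))
      = (1 + ((2*n:ℕ)+1/2)/(4*(((2*n:ℕ):ℝ)+1))) := by
    push_cast; field_simp; ring
  rw [e] at h
  refine h.congr (fun j => ?_)
  unfold br
  rw [show (j:ℝ) + ((n:ℝ)+1) = (j:ℝ)+n+1 by ring, show (3*(j:ℝ)+1/2) = 3*((j:ℝ)+1/6) by ring]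
  have h1 : (j:ℝ)+1/6 ≠ 0 := by positivity
  have h2 : (j:ℝ)+n+1 ≠ 0 := by positivity
  have h3 : 2*(n:ℝ)+1 ≠ 0 := by positivity
  generalize hu : (j:ℝ)+1/6 = u at *
  field_simp
  ring

lemma FF_tendsto (n : ℕ) : Filter.Tendsto (fun j => FF n j) Filter.atTop
    (nhds (3/(2*π) * (cc (2*n) + cc (2*n+1)))) := by
  have h := (kap_tendsto.mul (prod_rho_tendsto n)).mul (br_tendsto n)
  have e : 3/(2*π) * (cc (2*n) + cc (2*n+1)) =
      3/(2*π) * cc (2*n) * (1 + ((2*n:ℕ)+1/2)/(4*(((2*n:ℕ):ℝ)+1))) := by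
    rw [cc_succ]; ring
  rw [e]
  refine h.congr (fun j => ?_)
  unfold FF KK
  have h1 : 3*(j:ℝ)+1/2 ≠ 0 := by positivity
  generalize hu : 3*(j:ℝ)+1/2 = u at *
  field_simp

lemma sum_FF : ∑' n, FF n 0 = 3/(2*π) * (2/Real.sqrt 3) := by
  have h := tendsto_tsum_of_dominated_convergence (𝓕 := Filter.atTop) (f := fun j n => FF n j)
    bound_summable FF_tendsto (Filter.Eventually.of_forall (fun j n => FF_abs n j))
  simp_rw [sum_const] at h
  rw [tendsto_nhds_unique tendsto_const_nhds h, tsum_mul_left]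
  congr 1
  have hs := cc_hasSum.summable
  have se : Summable (fun k => cc (2*k)) :=
    hs.comp_injective (i := fun k : ℕ => 2*k) (fun a b h => by simpa using h)
  have so : Summable (fun k => cc (2*k+1)) :=
    hs.comp_injective (i := fun k : ℕ => 2*k+1) (fun a b h => by simpa using h)
  rw [se.tsum_add so, tsum_even_add_odd se so, cc_hasSum.tsum_eq]

lemma poch_succ (a : ℝ) (n : ℕ) : poch a (n+1) = poch a n * (a+n) := by
  unfold poch; rw [ascPochhammer_succ_eval]

lemma poch_one_pos (n : ℕ) : 0 < poch 1 n := by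
  unfold poch; exact ascPochhammer_pos n 1 one_pos

lemma KK_zero (n : ℕ) :
    (poch (1/2) n * poch (1/4) n * poch (3/4) n) / (poch 1 n)^3 * ((-1:ℝ)/48)^n = KK n 0 := by
  induction n with
  | zero => simp [poch, KK, kap]
  | succ n ih =>
    rw [KK_succ_left, ← ih]
    simp only [poch_succ]
    have := (poch_one_pos n).ne'
    unfold rho
    push_cast
    have h1 : (1:ℝ)+n ≠ 0 := by positivity
    field_simp
    ring

lemma FF_zero (n : ℕ) : FF n 0 = 3/16 * (KK n 0 * (28*(n:ℝ)+3)) := by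
  unfold FF br
  push_cast
  field_simp
  ring

theorem stmt_17 :
    ∑' n : ℕ, (poch (1/2) n * poch (1/4) n * poch (3/4) n) / (poch 1 n)^3 * (28*(n:ℝ)+3) * ((-1:ℝ)/48)^n = 16 * Real.sqrt 3 / (3*π) := by
  have h := sum_FF
  simp_rw [FF_zero] at h
  rw [tsum_mul_left] at h
  have e : ∀ n : ℕ, (poch (1/2) n * poch (1/4) n * poch (3/4) n) / (poch 1 n)^3 * (28*(n:ℝ)+3) * ((-1:ℝ)/48)^n
      = KK n 0 * (28*(n:ℝ)+3) := by
    intro n; rw [← KK_zero]; ring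
  simp_rw [e]
  have h3 : Real.sqrt 3 * Real.sqrt 3 = 3 := Real.mul_self_sqrt (by norm_num)
  have h4 : Real.sqrt 3 ≠ 0 := by positivity
  have h5 : (2/Real.sqrt 3) = 2*Real.sqrt 3/3 := by
    field_simp; linarith
  rw [h5] at h
  have h6 := Real.pi_ne_zero
  have : ∑' n : ℕ, KK n 0 * (28*(n:ℝ)+3) = 16/3 * (3/(2*π) * (2*Real.sqrt 3/3)) := by linarith
  rw [this]
  field_simp
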